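/- Let μ₁ and μ₂ be Borel probability measures on ℝ with finite second moments, and let a = −∫ x dμ₁(x) and b = (1/2)(∫ x² dμ₁(x) + log(2π)). Then the function y ↦ p_Y(y;μ₂) log p_Y(y;μ₁) is integrable on ℝ, with ∫_ℝ |p_Y(y;μ₂) log p_Y(y;μ₁)| dy ≤ (1/2)∫ x² dμ₂(x) + a ∫ x dμ₂(x) + b + 1/2 < ∞. -/

import Mathlib

open MeasureTheory Real

/-- The standard Gaussian density `φ(t) = (2π)^{-1/2} e^{-t²/2}`. -/
noncomputable def gauss (t : ℝ) : ℝ := Real.exp (-t ^ 2 / 2) / Real.sqrt (2 * Real.pi)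

/-- The output density `p_Y(y;μ) = ∫ φ(y−x) dμ(x)`. -/
noncomputable def outDen (μ : Measure ℝ) (y : ℝ) : ℝ := ∫ x, gauss (y - x) ∂μ

open ProbabilityTheory in
lemma gauss_eq (x y : ℝ) : gauss (y - x) = gaussianPDFReal x 1 y := by
  simp only [gauss, gaussianPDFReal, NNReal.coe_one, mul_one]
  rw [div_eq_inv_mul]

lemma gauss_pos (t : ℝ) : 0 < gauss t := by unfold gauss; positivity

lemma sqrt_two_pi_ge : 1 ≤ Real.sqrt (2 * Real.pi) := by
  rw [Real.one_le_sqrt]; nlinarith [Real.pi_gt_three]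

lemma gauss_le_one (t : ℝ) : gauss t ≤ 1 := by
  unfold gauss
  rw [div_le_one (by positivity)]
  refine le_trans ?_ sqrt_two_pi_ge
  rw [Real.exp_le_one_iff]; nlinarith [sq_nonneg t]

lemma gauss_cont : Continuous gauss := by unfold gauss; fun_prop

lemma gauss_int (μ : Measure ℝ) [IsProbabilityMeasure μ] (y : ℝ) :
    Integrable (fun x => gauss (y - x)) μ := by
  refine Integrable.of_bound (C := 1) ?_ ?_
  · exact (gauss_cont.comp (by fun_prop)).aestronglyMeasurable
  · refine Filter.Eventually.of_forall fun x => ?_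
    rw [Real.norm_eq_abs, abs_of_pos (gauss_pos _)]
    exact gauss_le_one _

lemma gauss_exp (t : ℝ) : gauss t = Real.exp (-t ^ 2 / 2 - Real.log (2 * Real.pi) / 2) := by
  rw [Real.exp_sub, gauss, ← Real.log_sqrt (by positivity), Real.exp_log (by positivity)]

lemma log_bound (μ : Measure ℝ) [IsProbabilityMeasure μ]
    (h1 : Integrable (fun x : ℝ => x) μ) (h2 : Integrable (fun x : ℝ => x ^ 2) μ) (y : ℝ) :
    |Real.log (outDen μ y)| ≤ y ^ 2 / 2 + (-∫ x, x ∂μ) * y +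
      (1 / 2) * ((∫ x, x ^ 2 ∂μ) + Real.log (2 * Real.pi)) := by
  have hI : ∫ x, (-(y - x) ^ 2 / 2 - Real.log (2 * Real.pi) / 2) ∂μ =
      -(y ^ 2 / 2 + (-∫ x, x ∂μ) * y +
      (1 / 2) * ((∫ x, x ^ 2 ∂μ) + Real.log (2 * Real.pi))) ∧
      Integrable (fun x => (-(y - x) ^ 2 / 2 - Real.log (2 * Real.pi) / 2)) μ := by
    have e : (fun x : ℝ => (-(y - x) ^ 2 / 2 - Real.log (2 * Real.pi) / 2)) =
      fun x => (y * x + (-1 / 2) * x ^ 2) + (- y ^ 2 / 2 - Real.log (2 * Real.pi) / 2) := by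
      ext x; ring
    have i1 : Integrable (fun x : ℝ => y * x) μ := h1.const_mul _
    have i2 : Integrable (fun x : ℝ => (-1 / 2) * x ^ 2) μ := h2.const_mul _
    have i3 : Integrable (fun x : ℝ => y * x + (-1 / 2) * x ^ 2) μ := i1.add i2
    rw [e]
    refine ⟨?_, i3.add (integrable_const _)⟩
    rw [integral_add i3 (integrable_const _), integral_add i1 i2, integral_const_mul,
      integral_const_mul]
    simp
    ring
  have hJ := convexOn_exp.map_integral_le (μ := μ)
    (f := fun x => (-(y - x) ^ 2 / 2 - Real.log (2 * Real.pi) / 2))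
    Real.continuous_exp.continuousOn isClosed_univ (by simp) hI.2
    (by simpa only [Function.comp_def, gauss_exp] using gauss_int μ y)
  simp only [← gauss_exp] at hJ
  rw [hI.1] at hJ
  change _ ≤ outDen μ y at hJ
  have hp : 0 < outDen μ y := lt_of_lt_of_le (Real.exp_pos _) hJ
  have hle : outDen μ y ≤ 1 := by
    have := integral_mono (gauss_int μ y) (integrable_const (1 : ℝ)) (fun x => gauss_le_one _)
    simpa [outDen] using this
  rw [abs_of_nonpos (Real.log_nonpos hp.le hle)]
  have := (Real.le_log_iff_exp_le hp).2 hJ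
  linarith

open ProbabilityTheory in
lemma gauss_quad (a b x : ℝ) :
    Integrable (fun y => gauss (y - x) * (y ^ 2 / 2 + a * y + b)) ∧
    ∫ y, gauss (y - x) * (y ^ 2 / 2 + a * y + b) = x ^ 2 / 2 + a * x + b + 1 / 2 := by
  have m2 : MemLp (fun y : ℝ => y) 2 (gaussianReal x 1) := memLp_id_gaussianReal 2
  have i1 : Integrable (fun y : ℝ => y) (gaussianReal x 1) := m2.integrable (by norm_num)
  have i2 : Integrable (fun y : ℝ => y ^ 2) (gaussianReal x 1) := m2.integrable_sq
  have v : ∫ y, y ^ 2 ∂(gaussianReal x 1) = 1 + x ^ 2 := by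
    have h := variance_eq_sub m2
    rw [variance_fun_id_gaussianReal] at h
    simp [integral_id_gaussianReal] at h
    linarith
  have j2 : Integrable (fun y : ℝ => y ^ 2 / 2) (gaussianReal x 1) := i2.div_const _
  have j1 : Integrable (fun y : ℝ => a * y) (gaussianReal x 1) := i1.const_mul _
  have j3 : Integrable (fun y : ℝ => y ^ 2 / 2 + a * y) (gaussianReal x 1) := j2.add j1
  have j4 : Integrable (fun y : ℝ => y ^ 2 / 2 + a * y + b) (gaussianReal x 1) :=
    j3.add (integrable_const _)
  simp only [gauss_eq]
  constructor
  · rw [gaussianReal_of_var_ne_zero _ one_ne_zero, integrable_withDensity_iff_integrable_smul'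
      (measurable_gaussianPDF _ _) (by simp [gaussianPDF])] at j4
    simpa [gaussianPDF, gaussianPDFReal_nonneg] using j4
  · have h := integral_gaussianReal_eq_integral_smul (μ := x) (v := 1) one_ne_zero
      (f := fun y : ℝ => y ^ 2 / 2 + a * y + b)
    simp only [smul_eq_mul] at h
    rw [← h, integral_add j3 (integrable_const _), integral_add j2 j1, integral_div,
      integral_const_mul, v]
    simp [integral_id_gaussianReal]
    ring

lemma outDen_meas (μ : Measure ℝ) [IsProbabilityMeasure μ] : Measurable (outDen μ) := by
  have : StronglyMeasurable (fun p : ℝ × ℝ => gauss (p.1 - p.2)) :=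
    (gauss_cont.comp (by fun_prop)).stronglyMeasurable
  exact this.integral_prod_right.measurable

/-- for probability measures `μ₁, μ₂` with finite second moments, with
`a = −∫ x dμ₁` and `b = (1/2)(∫ x² dμ₁ + log(2π))`, the function
`y ↦ p_Y(y;μ₂) log p_Y(y;μ₁)` is (Lebesgue) integrable on `ℝ` and
`∫ |p_Y(y;μ₂) log p_Y(y;μ₁)| dy ≤ (1/2)∫x²dμ₂ + a ∫x dμ₂ + b + 1/2 < ∞`. -/
theorem outDen_mul_log_outDen_integrable (μ₁ μ₂ : Measure ℝ)
    [IsProbabilityMeasure μ₁] [IsProbabilityMeasure μ₂]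
    (h11 : Integrable (fun x : ℝ => x) μ₁) (h12 : Integrable (fun x : ℝ => x ^ 2) μ₁)
    (h21 : Integrable (fun x : ℝ => x) μ₂) (h22 : Integrable (fun x : ℝ => x ^ 2) μ₂)
    (a b : ℝ) (ha : a = -∫ x, x ∂μ₁)
    (hb : b = (1 / 2) * ((∫ x, x ^ 2 ∂μ₁) + Real.log (2 * Real.pi))) :
    Integrable (fun y : ℝ => outDen μ₂ y * Real.log (outDen μ₁ y)) ∧
      ∫ y : ℝ, |outDen μ₂ y * Real.log (outDen μ₁ y)| ≤
        (1 / 2) * (∫ x, x ^ 2 ∂μ₂) + a * (∫ x, x ∂μ₂) + b + 1 / 2 := by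
  have hq : ∀ y, |Real.log (outDen μ₁ y)| ≤ y ^ 2 / 2 + a * y + b := by
    intro y; rw [ha, hb]; exact log_bound μ₁ h11 h12 y
  have hq0 : ∀ y, 0 ≤ y ^ 2 / 2 + a * y + b := fun y => (abs_nonneg _).trans (hq y)
  have k2 : Integrable (fun x : ℝ => x ^ 2 / 2) μ₂ := h22.div_const _
  have k1 : Integrable (fun x : ℝ => a * x) μ₂ := h21.const_mul _
  have k3 : Integrable (fun x : ℝ => x ^ 2 / 2 + a * x) μ₂ := k2.add k1
  have k4 : Integrable (fun x : ℝ => x ^ 2 / 2 + a * x + b) μ₂ := k3.add (integrable_const _)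
  have k5 : Integrable (fun x : ℝ => x ^ 2 / 2 + a * x + b + 1 / 2) μ₂ :=
    k4.add (integrable_const _)
  have hF : Integrable (fun p : ℝ × ℝ => gauss (p.2 - p.1) * (p.2 ^ 2 / 2 + a * p.2 + b))
      (μ₂.prod volume) := by
    have hc : Continuous (fun p : ℝ × ℝ => gauss (p.2 - p.1) * (p.2 ^ 2 / 2 + a * p.2 + b)) :=
      (gauss_cont.comp (by fun_prop)).mul (by fun_prop)
    rw [integrable_prod_iff hc.aestronglyMeasurable]
    refine ⟨Filter.Eventually.of_forall fun x => (gauss_quad a b x).1, ?_⟩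
    have e : ∀ x y : ℝ, ‖gauss (y - x) * (y ^ 2 / 2 + a * y + b)‖ =
        gauss (y - x) * (y ^ 2 / 2 + a * y + b) := fun x y => by
      rw [Real.norm_eq_abs, abs_of_nonneg (mul_nonneg (gauss_pos _).le (hq0 y))]
    simp only [e, (gauss_quad a b _).2]
    exact k5
  have hG : Integrable (fun y => outDen μ₂ y * (y ^ 2 / 2 + a * y + b)) := by
    have := hF.integral_prod_right
    simpa only [integral_mul_const, outDen] using this
  have hGi : ∫ y, outDen μ₂ y * (y ^ 2 / 2 + a * y + b) =
      (1 / 2) * (∫ x, x ^ 2 ∂μ₂) + a * (∫ x, x ∂μ₂) + b + 1 / 2 := by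
    have h := integral_integral_swap (μ := μ₂) (ν := volume)
      (f := fun x y => gauss (y - x) * (y ^ 2 / 2 + a * y + b)) hF
    simp only [integral_mul_const, (gauss_quad a b _).2] at h
    change _ = ∫ y, outDen μ₂ y * (y ^ 2 / 2 + a * y + b) at h
    rw [← h, integral_add k4 (integrable_const _), integral_add k3 (integrable_const _),
      integral_add k2 k1, integral_div, integral_const_mul]
    simp
    ring
  have hb' : ∀ y, |outDen μ₂ y * Real.log (outDen μ₁ y)| ≤
      outDen μ₂ y * (y ^ 2 / 2 + a * y + b) := fun y => by
    have h0 : 0 ≤ outDen μ₂ y := integral_nonneg fun x => (gauss_pos _).le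
    rw [abs_mul, abs_of_nonneg h0]
    exact mul_le_mul_of_nonneg_left (hq y) h0
  have hI : Integrable (fun y : ℝ => outDen μ₂ y * Real.log (outDen μ₁ y)) :=
    hG.mono' ((outDen_meas μ₂).mul (outDen_meas μ₁).log).aestronglyMeasurable
      (Filter.Eventually.of_forall hb')
  exact ⟨hI, hGi ▸ integral_mono hI.abs hG hb'⟩
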